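/- The group PSL₂(K), for K a field, contains an element of order n (with n invertible in K) if and only if ζ_{2n} + ζ_{2n}^{-1} ∈ K, where ζ_{2n} is a primitive 2n-th root of unity in an algebraic closure of K. -/

import Mathlib

theorem stmt8_pow_aux {R : Type*} [CommRing R] (A : Matrix (Fin 2) (Fin 2) R) (l l' : R)
    (hl : l * l' = 1) (ht : A 0 0 + A 1 1 = l + l') (hd : A 0 0 * A 1 1 - A 0 1 * A 1 0 = 1)
    (m : ℕ) :
    (l - l') • A ^ (m + 1) = (l ^ (m + 1) - l' ^ (m + 1)) • A - (l ^ m - l' ^ m) • 1 := by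
  have hA : A * A = (l + l') • A - 1 := by
    rw [← ht]
    ext i j
    fin_cases i <;> fin_cases j <;> simp [Matrix.mul_apply, Fin.sum_univ_two] <;>
      first | ring1 | linear_combination (-1 : R) * hd
  induction m with
  | zero => simp
  | succ m ih =>
    rw [pow_succ, ← smul_mul_assoc, ih, sub_mul, smul_mul_assoc, hA]
    ext i j
    simp only [Matrix.sub_apply, Matrix.smul_apply, smul_eq_mul, smul_mul_assoc, one_mul]
    linear_combination (A i j) * (l ^ m - l' ^ m) * hl

theorem stmt8_pow_eq {R : Type*} [CommRing R] (A : Matrix (Fin 2) (Fin 2) R) (e : R)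
    (he : e * e = 1) (ht : A 0 0 + A 1 1 = e + e) (hd : A 0 0 * A 1 1 - A 0 1 * A 1 0 = 1)
    (m : ℕ) :
    A ^ (m + 1) = ((m + 1 : R) * e ^ m) • A - (m * e ^ (m + 1)) • 1 := by
  have hA : A * A = (e + e) • A - 1 := by
    rw [← ht]
    ext i j
    fin_cases i <;> fin_cases j <;> simp [Matrix.mul_apply, Fin.sum_univ_two] <;>
      first | ring1 | linear_combination (-1 : R) * hd
  induction m with
  | zero => simp
  | succ m ih =>
    rw [pow_succ, ih, sub_mul, smul_mul_assoc, hA]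
    ext i j
    simp only [Matrix.sub_apply, Matrix.smul_apply, smul_eq_mul, smul_mul_assoc, one_mul]
    push_cast
    linear_combination ((1 : Matrix (Fin 2) (Fin 2) R) i j) * (m + 1) * e ^ m * he

theorem stmt8_center {K : Type*} [Field K] (A : Matrix.SpecialLinearGroup (Fin 2) K) :
    A ∈ Subgroup.center (Matrix.SpecialLinearGroup (Fin 2) K) ↔
      A.1 0 1 = 0 ∧ A.1 1 0 = 0 ∧ A.1 0 0 = A.1 1 1 := by
  rw [Matrix.SpecialLinearGroup.mem_center_iff]
  constructor
  · rintro ⟨r, -, h⟩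
    rw [← h]; simp
  · rintro ⟨h1, h2, h3⟩
    have hd := A.2
    rw [Matrix.det_fin_two] at hd
    refine ⟨A.1 0 0, ?_, ?_⟩
    · simp only [Fintype.card_fin]
      rw [h1, ← h3] at hd
      linear_combination hd
    · ext i j
      fin_cases i <;> fin_cases j <;> simp_all

theorem stmt8_order {K L : Type*} [Field K] [Field L] [Algebra K L]
    (A : Matrix.SpecialLinearGroup (Fin 2) K) (l : L) (h0 : l ≠ 0) (hl : l ^ 2 ≠ 1)
    (ht : algebraMap K L (A.1 0 0 + A.1 1 1) = l + l⁻¹) :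
    orderOf (QuotientGroup.mk A : Matrix.SpecialLinearGroup (Fin 2) K ⧸
        Subgroup.center (Matrix.SpecialLinearGroup (Fin 2) K)) = orderOf (l ^ 2) := by
  rw [orderOf_eq_orderOf_iff]
  intro m
  rw [← QuotientGroup.mk_pow, QuotientGroup.eq_one_iff, stmt8_center]
  rcases m with _ | m
  · simp
  have hll : l * l⁻¹ = 1 := mul_inv_cancel₀ h0
  have hd := A.2
  rw [Matrix.det_fin_two] at hd
  have hd' := congrArg (algebraMap K L) hd
  simp only [map_sub, map_mul, map_one] at hd'
  rw [map_add] at ht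
  have key := stmt8_pow_aux (A.1.map (algebraMap K L)) l l⁻¹ hll (by simpa using ht)
    (by simpa using hd') m
  rw [← Matrix.map_pow] at key
  have hne : l - l⁻¹ ≠ 0 := by
    intro h
    apply hl
    linear_combination l * h + hll
  have hpow : (l ^ 2) ^ (m + 1) = 1 ↔ l ^ (m + 1) - l⁻¹ ^ (m + 1) = 0 := by
    have h1 : l ^ (m + 1) * l⁻¹ ^ (m + 1) = 1 := by rw [← mul_pow, hll, one_pow]
    have h2 : (l ^ 2) ^ (m + 1) = l ^ (m + 1) * l ^ (m + 1) := by ring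
    have h3 : l ^ (m + 1) ≠ 0 := pow_ne_zero _ h0
    rw [h2]
    constructor
    · intro h
      apply mul_left_cancel₀ h3
      linear_combination h - h1
    · intro h
      linear_combination l ^ (m + 1) * h + h1
  rw [hpow, Matrix.SpecialLinearGroup.coe_pow]
  have inj := FaithfulSMul.algebraMap_injective K L
  generalize (A.1 ^ (m + 1)) = B at key
  have k01 := congrFun (congrFun key 0) 1
  have k10 := congrFun (congrFun key 1) 0
  have k00 := congrFun (congrFun key 0) 0
  have k11 := congrFun (congrFun key 1) 1
  simp only [Matrix.sub_apply, Matrix.smul_apply, smul_eq_mul, Matrix.map_apply] at k01 k10 k00 k11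
  simp only [Matrix.one_apply_eq, ne_eq, zero_ne_one, one_ne_zero, not_false_eq_true,
    Matrix.one_apply_ne, mul_zero, sub_zero, mul_one] at k01 k10 k00 k11
  constructor
  · rintro ⟨h1, h2, h3⟩
    by_contra hu
    rw [h1, map_zero, mul_zero] at k01
    rw [h2, map_zero, mul_zero] at k10
    rw [h3] at k00
    have a01 := (mul_eq_zero.1 k01.symm).resolve_left hu
    have a10 := (mul_eq_zero.1 k10.symm).resolve_left hu
    have a00 : algebraMap K L (A.1 0 0) = algebraMap K L (A.1 1 1) := by
      apply mul_left_cancel₀ hu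
      linear_combination k11 - k00
    rw [a01, a00] at hd'
    rw [a00] at ht
    apply hne
    have : (l - l⁻¹) ^ 2 = 0 := by
      linear_combination -4 * hll + 4 * hd' - (l + l⁻¹ + 2 * algebraMap K L (A.1 1 1)) * ht
    exact pow_eq_zero_iff (two_ne_zero) |>.1 this
  · intro hu
    rw [hu] at k01 k10 k00 k11
    refine ⟨inj ?_, inj ?_, inj ?_⟩
    · rw [map_zero]
      exact (mul_eq_zero.1 (k01.trans (zero_mul _))).resolve_left hne
    · rw [map_zero]
      exact (mul_eq_zero.1 (k10.trans (zero_mul _))).resolve_left hne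
    · apply mul_left_cancel₀ hne
      linear_combination k00 - k11

theorem stmt8_mem {L : Type*} [Field L] (S : Subring L) (l : L) (h0 : l ≠ 0)
    (h : l + l⁻¹ ∈ S) (i : ℕ) : l ^ i + l⁻¹ ^ i ∈ S := by
  have hll : l * l⁻¹ = 1 := mul_inv_cancel₀ h0
  induction i using Nat.twoStepInduction with
  | zero => simpa using S.add_mem S.one_mem S.one_mem
  | one => simpa using h
  | more i h1 h2 =>
    have : l ^ (i + 2) + l⁻¹ ^ (i + 2)
        = (l ^ (i + 1) + l⁻¹ ^ (i + 1)) * (l + l⁻¹) - (l ^ i + l⁻¹ ^ i) := by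
      linear_combination -(l ^ i + l⁻¹ ^ i) * hll
    rw [this]
    exact S.sub_mem (S.mul_mem h2 h) h1

/-- For a field `K` and `n` invertible in `K`, the group `PSL₂(K)` contains an element of
order `n` if and only if `ζ_{2n} + ζ_{2n}⁻¹ ∈ K`, where `ζ_{2n}` is a primitive `2n`-th
root of unity in an algebraic closure of `K`. -/
theorem stmt8 (K : Type*) [Field K] (n : ℕ) (hn : 0 < n) (hinv : (n : K) ≠ 0)
    (ζ : AlgebraicClosure K) (hζ : IsPrimitiveRoot ζ (2 * n)) :
    (∃ g : Matrix.SpecialLinearGroup (Fin 2) K ⧸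
        Subgroup.center (Matrix.SpecialLinearGroup (Fin 2) K), orderOf g = n) ↔
      ζ + ζ⁻¹ ∈ Set.range (algebraMap K (AlgebraicClosure K)) := by
  have hζ2 : IsPrimitiveRoot (ζ ^ 2) n := hζ.pow (by omega) rfl
  have hζ0 : ζ ≠ 0 := hζ.ne_zero (by omega)
  by_cases h1 : n = 1
  · subst h1
    refine ⟨fun _ => ?_, fun _ => ⟨1, orderOf_one⟩⟩
    have : ζ = -1 := IsPrimitiveRoot.eq_neg_one_of_two_right (by simpa using hζ)
    rw [this]
    exact ⟨-1 + -1, by simp [inv_neg]⟩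
  constructor
  · rintro ⟨g, hg⟩
    obtain ⟨A, rfl⟩ := QuotientGroup.mk_surjective g
    obtain ⟨l, hl⟩ := IsAlgClosed.exists_root
      (Polynomial.C 1 * Polynomial.X ^ 2
        + Polynomial.C (-algebraMap K (AlgebraicClosure K) (A.1 0 0 + A.1 1 1)) * Polynomial.X
        + Polynomial.C 1) (by
        rw [Polynomial.degree_quadratic one_ne_zero]; decide)
    have hl' : l ^ 2 - algebraMap K (AlgebraicClosure K) (A.1 0 0 + A.1 1 1) * l + 1 = 0 := by
      simp [Polynomial.IsRoot] at hl
      rw [map_add]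
      linear_combination hl
    have l0 : l ≠ 0 := by
      rintro rfl
      simp at hl'
    have hll : l * l⁻¹ = 1 := mul_inv_cancel₀ l0
    have ht : algebraMap K (AlgebraicClosure K) (A.1 0 0 + A.1 1 1) = l + l⁻¹ := by
      apply mul_left_cancel₀ l0
      linear_combination -hl' - hll
    by_cases hl2 : l ^ 2 = 1
    · exfalso
      obtain ⟨m, rfl⟩ : ∃ m, n = m + 1 := ⟨n - 1, by omega⟩
      obtain ⟨e, he, hte⟩ : ∃ e : K, e * e = 1 ∧ A.1 0 0 + A.1 1 1 = e + e := by
        have inj := FaithfulSMul.algebraMap_injective K (AlgebraicClosure K)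
        rcases (sq_eq_sq_iff_eq_or_eq_neg.1 (hl2.trans (one_pow 2).symm)) with h | h
        · exact ⟨1, by ring, inj (by rw [ht, h]; simp)⟩
        · exact ⟨-1, by ring, inj (by rw [ht, h]; simp [inv_neg])⟩
      have hd := A.2
      rw [Matrix.det_fin_two] at hd
      have key := stmt8_pow_eq A.1 e he hte hd m
      have hc := pow_orderOf_eq_one (QuotientGroup.mk A : Matrix.SpecialLinearGroup (Fin 2) K ⧸
        Subgroup.center (Matrix.SpecialLinearGroup (Fin 2) K))
      rw [hg, ← QuotientGroup.mk_pow, QuotientGroup.eq_one_iff, stmt8_center,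
        Matrix.SpecialLinearGroup.coe_pow, key] at hc
      have e0 : e ≠ 0 := left_ne_zero_of_mul_eq_one he
      have hu : ((m + 1 : K) * e ^ m) ≠ 0 :=
        mul_ne_zero (by exact_mod_cast hinv) (pow_ne_zero _ e0)
      simp only [Matrix.sub_apply, Matrix.smul_apply, smul_eq_mul, Matrix.one_apply_eq, ne_eq,
        zero_ne_one, one_ne_zero, not_false_eq_true, Matrix.one_apply_ne, mul_zero, sub_zero,
        mul_one] at hc
      obtain ⟨c1, c2, c3⟩ := hc
      have : A ∈ Subgroup.center (Matrix.SpecialLinearGroup (Fin 2) K) := by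
        rw [stmt8_center]
        refine ⟨(mul_eq_zero.1 c1).resolve_left hu, (mul_eq_zero.1 c2).resolve_left hu, ?_⟩
        apply mul_left_cancel₀ hu
        linear_combination c3
      rw [← QuotientGroup.eq_one_iff] at this
      rw [this, orderOf_one] at hg
      exact h1 hg.symm
    · have ho := stmt8_order A l l0 hl2 ht
      rw [hg] at ho
      have hp : IsPrimitiveRoot (l ^ 2) n := by rw [ho]; exact IsPrimitiveRoot.orderOf _
      have : NeZero n := ⟨hn.ne'⟩
      obtain ⟨i, -, hi⟩ := hp.eq_pow_of_pow_eq_one hζ2.pow_eq_one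
      have hm := stmt8_mem (algebraMap K (AlgebraicClosure K)).range l l0 ⟨_, ht⟩ i
      have : ζ ^ 2 = (l ^ i) ^ 2 := by rw [← hi]; ring
      change ζ + ζ⁻¹ ∈ (algebraMap K (AlgebraicClosure K)).range
      rcases sq_eq_sq_iff_eq_or_eq_neg.1 this with h | h
      · rw [h, ← inv_pow]; exact hm
      · rw [h, inv_neg, ← inv_pow, ← neg_add]; exact neg_mem hm
  · rintro ⟨t, ht⟩
    let A : Matrix.SpecialLinearGroup (Fin 2) K := ⟨!![0, -1; 1, t], by simp [Matrix.det_fin_two]⟩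
    refine ⟨QuotientGroup.mk A, ?_⟩
    rw [stmt8_order A ζ hζ0 ?_ (by simpa [A] using ht)]
    · exact hζ2.eq_orderOf.symm
    · intro h
      rw [h] at hζ2
      exact h1 (hζ2.unique IsPrimitiveRoot.one)
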